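/- Suppose every vertex-transitive graph H satisfies χ(H) ≤ ⌈(ω(H) + Δ(H) + 1)/2⌉. Then every vertex-transitive graph G with Δ(G) ≥ 9 and no clique of size Δ(G) satisfies χ(G) ≤ Δ(G) − 1. -/

import Mathlib

open SimpleGraph

/-- A graph is vertex-transitive if its automorphism group acts transitively
on the vertices. -/
def VertexTransitive {V : Type*} (G : SimpleGraph V) : Prop :=
  ∀ u v : V, ∃ e : G ≃g G, e u = v

/-- The neighbors of `u` that have color `α`. -/
def leaves {V κ : Type*} [Fintype V] [DecidableEq κ] (H : SimpleGraph V) [DecidableRel H.Adj]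
    (c : V → κ) (α : κ) (u : V) : Finset V :=
  {w | H.Adj u w ∧ c w = α}

section Stars

variable {V ι κ : Type*} [Fintype V] [DecidableEq κ]
  {H : SimpleGraph V} [DecidableRel H.Adj] {p : V → ι} {α : κ} {v : V} {c : V → κ}
  {m d : ℕ} {x : ℕ → V}

theorem mem_leaves {u w : V} : w ∈ leaves H c α u ↔ H.Adj u w ∧ c w = α := by
  simp [leaves]

/-- A sequence of stars with centers `x 0, …, x m`, where `x 0 = v`, and whose leaves have
color `α`. Each center other than `v` shares its part with a leaf of an earlier star, and
exchanging the colors of these two vertices creates no conflict, except possibly one between the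
leaf and the center of its star when it is the only leaf of that star. -/
structure StarSequence (H : SimpleGraph V) [DecidableRel H.Adj] (p : V → ι) (α : κ) (v : V)
    (c : V → κ) (m : ℕ) (x : ℕ → V) : Prop where
  inj : ∀ a b, p a = p b → c a = c b → a = b
  root : x 0 = v
  root_color : c v = α
  center : ∀ j ≤ m, ∀ i < j, ¬ H.Adj (x i) (x j)
  leaf : ∀ j ≤ m, ∀ i < j, ∀ w ∈ leaves H c α (x i), ¬ H.Adj (x j) w
  parent : ∀ j ≤ m, 0 < j → ∃ i < j, ∃ w ∈ leaves H c α (x i), p w = p (x j) ∧ w ≠ x j ∧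
    ∀ y, H.Adj w y → c y = c (x j) → y = x i ∧ leaves H c α (x i) = {w}
  nonempty : ∀ j < m, (leaves H c α (x j)).Nonempty
  conflict : ∀ a b, H.Adj a b → c a = c b →
    a = v ∨ b = v ∨ (leaves H c α (x m) = ∅ ∧ (a = x m ∨ b = x m))

theorem card_part_le [DecidableEq ι] (hinj : ∀ a b, p a = p b → c a = c b → a = b) (w : V)
    (T : Finset V) :
    (Finset.univ.filter fun a ↦ p a = p w).card ≤
      (Finset.univ.filter fun a ↦ p a = p w ∧ c a ∉ T.image c).card + T.card := by
  have h1 : (Finset.univ.filter fun a ↦ p a = p w ∧ c a ∈ T.image c).card ≤ T.card := by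
    refine le_trans ?_ (Finset.card_image_le (s := T) (f := c))
    refine Finset.card_le_card_of_injOn c ?_ ?_
    · intro a ha
      simpa using (Finset.mem_filter.1 ha).2.2
    · intro a ha b hb hab
      simp only [Finset.coe_filter, Set.mem_ofPred_eq, Finset.mem_univ, true_and] at ha hb
      exact hinj a b (ha.1.trans hb.1.symm) hab
  have h2 := Finset.card_filter_add_card_filter_not (s := Finset.univ.filter fun a ↦ p a = p w)
    (fun a ↦ c a ∈ T.image c)
  rw [Finset.filter_filter, Finset.filter_filter] at h2
  omega

namespace StarSequence

theorem disjoint_leaves (h : StarSequence H p α v c m x) {i j : ℕ} (hj : j ≤ m) (hij : i < j) :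
    Disjoint (leaves H c α (x i)) (leaves H c α (x j)) := by
  rw [Finset.disjoint_left]
  intro w hi hj'
  exact h.leaf j hj i hij w hi (mem_leaves.1 hj').1

theorem center_ne (h : StarSequence H p α v c m x) {i j : ℕ} (hj : j ≤ m) (hij : i < j) :
    x i ≠ x j := by
  intro he
  have := h.disjoint_leaves hj hij
  rw [← he, disjoint_self] at this
  exact (h.nonempty i (by omega)).ne_empty this

theorem lt_card (h : StarSequence H p α v c m x) : m < Fintype.card V := by
  have : Function.Injective (fun i : Fin (m + 1) ↦ x i) := by
    intro i j hij
    rcases lt_trichotomy i j with hl | hl | hl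
    · exact absurd hij (h.center_ne (by omega) hl)
    · exact hl
    · exact absurd hij.symm (h.center_ne (by omega) hl)
  simpa using Fintype.card_le_of_injective _ this

theorem color_ne (h : StarSequence H p α v c m x) {j : ℕ} (hj : j ≤ m) (hj0 : 0 < j) :
    c (x j) ≠ α := by
  obtain ⟨i, -, w, hw, hp, hne, -⟩ := h.parent j hj hj0
  intro hc
  exact hne (h.inj _ _ hp ((mem_leaves.1 hw).2.trans hc.symm))

theorem leaf_ne_root (h : StarSequence H p α v c m x) {i : ℕ} (hi : i ≤ m) {w : V}
    (hw : w ∈ leaves H c α (x i)) : w ≠ v := by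
  rintro rfl
  have hadj := (mem_leaves.1 hw).1
  rcases Nat.eq_zero_or_pos i with rfl | hi0
  · rw [h.root] at hadj
    exact hadj.ne rfl
  · exact h.center i hi 0 hi0 (by rw [h.root]; exact hadj.symm)

/-- The sizes of the stars, with a value larger than all sizes beyond the end of the sequence. -/
def sizes (H : SimpleGraph V) [DecidableRel H.Adj] (α : κ) (c : V → κ) (m : ℕ) (x : ℕ → V) :
    Lex (Fin (Fintype.card V) → ℕ) :=
  toLex fun i ↦ if (i : ℕ) ≤ m then (leaves H c α (x i)).card else Fintype.card V + 1

theorem sizes_apply (i : Fin (Fintype.card V)) : sizes H α c m x i =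
    if (i : ℕ) ≤ m then (leaves H c α (x i)).card else Fintype.card V + 1 :=
  rfl

variable [DecidableEq V]

/-- If the last star has no leaves and is not the only one, recoloring shrinks an earlier star. -/
theorem shift (h : StarSequence H p α v c m x) (hm : 0 < m) (he : leaves H c α (x m) = ∅) :
    ∃ c' : V → κ, ∃ l < m, StarSequence H p α v c' l x ∧
      (∀ i < l, leaves H c' α (x i) = leaves H c α (x i)) ∧
      (leaves H c' α (x l)).card < (leaves H c α (x l)).card := by
  obtain ⟨l, hl, w, hw, hp, hne, hconf⟩ := h.parent m le_rfl hm
  have hxm := h.color_ne le_rfl hm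
  obtain ⟨hlw, hwα⟩ := mem_leaves.1 hw
  have hwv := h.leaf_ne_root hl.le hw
  have hxv : x m ≠ v := fun e ↦ hxm (e ▸ h.root_color)
  set c' : V → κ := fun a ↦ c (Equiv.swap (x m) w a) with hc'
  have c'w : c' w = c (x m) := by simp [hc']
  have c'x : c' (x m) = α := by simp [hc', hwα]
  have c'o : ∀ a, a ≠ x m → a ≠ w → c' a = c a := fun a h1 h2 ↦ by
    simp [hc', Equiv.swap_apply_of_ne_of_ne h1 h2]
  have key : ∀ i < m, leaves H c' α (x i) = (leaves H c α (x i)).erase w := by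
    intro i hi
    ext u
    rw [Finset.mem_erase, mem_leaves, mem_leaves]
    by_cases h1 : u = w
    · subst h1; simp [c'w, hxm]
    by_cases h2 : u = x m
    · subst h2; simp [h.center m le_rfl i hi]
    simp [c'o u h2 h1, h1]
  have key' : ∀ i < l, leaves H c' α (x i) = leaves H c α (x i) := by
    intro i hi
    rw [key i (by omega), Finset.erase_eq_of_notMem]
    exact fun hwi ↦ Finset.disjoint_left.1 (h.disjoint_leaves hl.le hi) hwi hw
  have sub : ∀ i < m, leaves H c' α (x i) ⊆ leaves H c α (x i) := fun i hi ↦ by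
    rw [key i hi]; exact Finset.erase_subset _ _
  have c'c : ∀ i ≤ l, 0 < i → c' (x i) = c (x i) := by
    intro i hi hi0
    refine c'o _ (h.center_ne le_rfl (by omega)) ?_
    rintro rfl
    exact h.color_ne (by omega) hi0 hwα
  refine ⟨c', l, hl, ⟨?_, h.root, ?_, ?_, ?_, ?_, ?_, ?_⟩, key', ?_⟩
  · intro a b hab hcab
    have hps : ∀ a, p (Equiv.swap (x m) w a) = p a := by
      intro a
      by_cases h1 : a = x m
      · subst h1; simp [hp]
      by_cases h2 : a = w
      · subst h2; simp [hp]
      rw [Equiv.swap_apply_of_ne_of_ne h1 h2]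
    exact (Equiv.swap (x m) w).injective (h.inj _ _ (by rw [hps, hps, hab]) hcab)
  · rw [c'o v hxv.symm hwv.symm, h.root_color]
  · exact fun j hj i hi ↦ h.center j (by omega) i hi
  · exact fun j hj i hi u hu ↦ h.leaf j (by omega) i hi u (sub i (by omega) hu)
  · intro j hj hj0
    obtain ⟨i, hi, u, hu, hpu, hune, hy⟩ := h.parent j (by omega) hj0
    rw [← key' i (by omega)] at hu hy
    refine ⟨i, hi, u, hu, hpu, hune, fun y hadj hyc ↦ ?_⟩
    rw [c'c j hj hj0] at hyc
    rw [key' i (by omega)] at hu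
    have huα := (mem_leaves.1 hu).2
    by_cases h1 : y = x m
    · subst h1
      exact absurd (hyc.symm.trans c'x) (h.color_ne (by omega) hj0)
    by_cases h2 : y = w
    · subst h2
      rcases h.conflict u y hadj (by rw [huα, hwα]) with e | e | ⟨-, e | e⟩
      · exact absurd e (h.leaf_ne_root (by omega) hu)
      · exact absurd e hwv
      · exact absurd (e ▸ huα) hxm
      · exact absurd e.symm (Ne.symm h1)
    exact hy y hadj (by rw [← hyc, c'o y h1 h2])
  · intro j hj
    rw [key' j hj]
    exact h.nonempty j (by omega)
  · have hxa : ∀ b, H.Adj (x m) b → c' b ≠ α := by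
      intro b hb hbα
      by_cases h2 : b = w
      · subst h2; exact hxm (c'w ▸ hbα)
      rw [c'o b hb.ne' h2] at hbα
      have : b ∈ leaves H c α (x m) := mem_leaves.2 ⟨hb, hbα⟩
      simp [he] at this
    have hwa : ∀ b, H.Adj w b → b ≠ x m → c' b = c (x m) →
        leaves H c' α (x l) = ∅ ∧ b = x l := by
      intro b hb h1 hbc
      rw [c'o b h1 hb.ne'] at hbc
      obtain ⟨rfl, hs⟩ := hconf b hb hbc
      exact ⟨by rw [key l hl, hs]; simp, rfl⟩
    intro a b hab hcab
    by_cases ha1 : a = x m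
    · subst ha1; exact absurd (hcab.symm.trans c'x) (hxa b hab)
    by_cases hb1 : b = x m
    · subst hb1; exact absurd (hcab.trans c'x) (hxa a hab.symm)
    by_cases ha2 : a = w
    · subst ha2
      obtain ⟨h1, h2⟩ := hwa b hab hb1 (hcab.symm.trans c'w)
      exact .inr (.inr ⟨h1, .inr h2⟩)
    by_cases hb2 : b = w
    · subst hb2
      obtain ⟨h1, h2⟩ := hwa a hab.symm ha1 (hcab.trans c'w)
      exact .inr (.inr ⟨h1, .inl h2⟩)
    rw [c'o a ha1 ha2, c'o b hb1 hb2] at hcab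
    rcases h.conflict a b hab hcab with e | e | ⟨-, e | e⟩
    · exact .inl e
    · exact .inr (.inl e)
    · exact absurd e ha1
    · exact absurd e hb1
  · rw [key l hl]
    exact Finset.card_erase_lt_of_mem hw

variable [DecidableEq ι]

/-- If every star has a leaf, the sequence can be extended. -/
theorem extend (h : StarSequence H p α v c m x) (hne : (leaves H c α (x m)).Nonempty)
    (hd2 : 2 ≤ d) (hdeg : ∀ u, H.degree u ≤ d)
    (hpart : ∀ w, 3 * d - 1 ≤ (Finset.univ.filter fun a ↦ p a = p w).card) :
    ∃ z, StarSequence H p α v c (m + 1) (Function.update x (m + 1) z) := by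
  have hnon : ∀ l ≤ m, (leaves H c α (x l)).Nonempty := fun l hl ↦
    (Nat.lt_or_eq_of_le hl).elim (h.nonempty l) (fun e ↦ e ▸ hne)
  have hconf : ∀ a b, H.Adj a b → c a = c b → a = v ∨ b = v := by
    intro a b hab hc
    rcases h.conflict a b hab hc with e | e | ⟨e, -⟩
    · exact .inl e
    · exact .inr e
    · exact absurd e hne.ne_empty
  obtain ⟨z, l, hl, w, hw, hpz, hwz, hyz, hzx, hzl⟩ : ∃ z, ∃ l ≤ m, ∃ w ∈ leaves H c α (x l),
      p w = p z ∧ w ≠ z ∧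
      (∀ y, H.Adj w y → c y = c z → y = x l ∧ leaves H c α (x l) = {w}) ∧
      (∀ i ≤ m, ¬ H.Adj (x i) z) ∧ ∀ i ≤ m, ∀ u ∈ leaves H c α (x i), ¬ H.Adj z u := by
    by_contra! hno
    let I := Finset.range (m + 1)
    let L : ℕ → Finset V := fun l ↦ leaves H c α (x l)
    let D : ℕ → Finset V := fun l ↦ (insert (x l) (L l)).biUnion fun u ↦ H.neighborFinset u
    let C : ℕ → V → Finset V := fun l w ↦ insert w (Finset.univ.filter fun z ↦
      p z = p w ∧ ∀ y, H.Adj w y → c y = c z → y = x l ∧ L l = {w})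
    let E : ℕ → Finset V := fun l ↦ (L l).biUnion (C l)
    have hpC : ∀ l w z, z ∈ C l w → p z = p w := by
      intro l w z hz
      rcases Finset.mem_insert.1 hz with rfl | hz
      · rfl
      · exact (Finset.mem_filter.1 hz).2.1
    have hLα : ∀ l w, w ∈ L l → c w = α := fun l w hw ↦ (mem_leaves.1 hw).2
    have hD : ∀ l, (D l).card ≤ d * ((L l).card + 1) := by
      intro l
      rw [mul_comm]
      refine (Finset.card_biUnion_le_card_mul _ _ d fun u _ ↦ hdeg u).trans ?_
      exact Nat.mul_le_mul_right _ (Finset.card_insert_le _ _)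
    have hC1 : ∀ l w, w ∈ L l → 2 * d - 1 ≤ (C l w).card := by
      intro l w hw
      have h1 := card_part_le h.inj w (H.neighborFinset w)
      have h2 : (Finset.univ.filter fun a ↦ p a = p w ∧ c a ∉ (H.neighborFinset w).image c).card
          ≤ (C l w).card := by
        refine Finset.card_le_card fun z hz ↦ Finset.mem_insert_of_mem ?_
        obtain ⟨-, hz1, hz2⟩ := Finset.mem_filter.1 hz
        refine Finset.mem_filter.2 ⟨Finset.mem_univ _, hz1, fun y hy hyc ↦ ?_⟩
        exact absurd (Finset.mem_image.2 ⟨y, by simpa using hy, hyc⟩) hz2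
      have h3 := hpart w
      have h4 := hdeg w
      rw [← H.card_neighborFinset_eq_degree] at h4
      omega
    have hC2 : ∀ l w, L l = {w} → 2 * d ≤ (C l w).card := by
      intro l w hw
      have hwl : w ∈ L l := by simp [hw]
      have h1 := card_part_le h.inj w ((H.neighborFinset w).erase (x l))
      have h2 : (Finset.univ.filter fun a ↦
          p a = p w ∧ c a ∉ ((H.neighborFinset w).erase (x l)).image c).card ≤ (C l w).card := by
        refine Finset.card_le_card fun z hz ↦ Finset.mem_insert_of_mem ?_
        obtain ⟨-, hz1, hz2⟩ := Finset.mem_filter.1 hz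
        refine Finset.mem_filter.2 ⟨Finset.mem_univ _, hz1, fun y hy hyc ↦ ⟨?_, hw⟩⟩
        by_contra hyx
        exact hz2 (Finset.mem_image.2 ⟨y, by simpa [hyx] using hy, hyc⟩)
      have h3 := hpart w
      have h4 := hdeg w
      rw [← H.card_neighborFinset_eq_degree] at h4
      have h5 : ((H.neighborFinset w).erase (x l)).card + 1 = (H.neighborFinset w).card :=
        Finset.card_erase_add_one (by simpa using (mem_leaves.1 hwl).1.symm)
      omega
    have hE : ∀ l ∈ I, d * ((L l).card + 1) ≤ (E l).card := by
      intro l hl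
      have hcard : (E l).card = ∑ w ∈ L l, (C l w).card := by
        refine Finset.card_biUnion fun a ha b hb hab ↦ ?_
        refine Finset.disjoint_left.2 fun z hza hzb ↦ hab ?_
        exact h.inj _ _ ((hpC l a z hza).symm.trans (hpC l b z hzb))
          ((hLα l a ha).trans (hLα l b hb).symm)
      have hpos : 1 ≤ (L l).card :=
        Finset.card_pos.2 (hnon l (by simpa [I, Nat.lt_succ_iff] using hl))
      rw [hcard]
      rcases Nat.eq_or_lt_of_le hpos with h1 | h1
      · obtain ⟨w, hw⟩ := Finset.card_eq_one.1 h1.symm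
        have := hC2 l w hw
        rw [hw]
        simp only [Finset.card_singleton, Finset.sum_singleton]
        omega
      · have h2 : (L l).card * (2 * d - 1) ≤ ∑ w ∈ L l, (C l w).card := by
          simpa using Finset.card_nsmul_le_sum (L l) (fun w ↦ (C l w).card) _ (hC1 l)
        refine le_trans ?_ h2
        obtain ⟨k, hk⟩ := Nat.exists_eq_add_of_lt h1
        obtain ⟨e, rfl⟩ := Nat.exists_eq_add_of_le hd2
        rw [hk, show 2 * (2 + e) - 1 = 3 + 2 * e by omega]
        nlinarith [Nat.zero_le (k * e)]
    have hdisj : ∀ a ∈ I, ∀ b ∈ I, a ≠ b → Disjoint (E a) (E b) := by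
      intro a ha b hb hab
      refine Finset.disjoint_left.2 fun z hza hzb ↦ ?_
      obtain ⟨u, hu, hzu⟩ := Finset.mem_biUnion.1 hza
      obtain ⟨w, hw, hzw⟩ := Finset.mem_biUnion.1 hzb
      obtain rfl : u = w := h.inj _ _ ((hpC a u z hzu).symm.trans (hpC b w z hzw))
          ((hLα a u hu).trans (hLα b w hw).symm)
      have ha' : a ≤ m := by simpa [I, Nat.lt_succ_iff] using ha
      have hb' : b ≤ m := by simpa [I, Nat.lt_succ_iff] using hb
      rcases hab.lt_or_gt with hlt | hlt
      · exact Finset.disjoint_left.1 (h.disjoint_leaves hb' hlt) hu hw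
      · exact Finset.disjoint_left.1 (h.disjoint_leaves ha' hlt) hw hu
    have hvE : v ∉ I.biUnion E := by
      intro hv
      obtain ⟨l, hl, hv⟩ := Finset.mem_biUnion.1 hv
      obtain ⟨w, hw, hvw⟩ := Finset.mem_biUnion.1 hv
      have hl' : l ≤ m := by simpa [I, Nat.lt_succ_iff] using hl
      exact h.leaf_ne_root hl' hw (h.inj _ _ (hpC l w v hvw).symm
        ((hLα l w hw).trans h.root_color.symm))
    have hsub : insert v (I.biUnion E) ⊆ I.biUnion D := by
      intro z hz
      rcases Finset.mem_insert.1 hz with rfl | hz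
      · obtain ⟨w, hw⟩ := hnon 0 (Nat.zero_le _)
        refine Finset.mem_biUnion.2 ⟨0, by simp [I], Finset.mem_biUnion.2
          ⟨w, Finset.mem_insert_of_mem hw, ?_⟩⟩
        have := (mem_leaves.1 hw).1
        rw [h.root] at this
        simpa using this.symm
      · obtain ⟨l, hl, hz⟩ := Finset.mem_biUnion.1 hz
        obtain ⟨w, hw, hzw⟩ := Finset.mem_biUnion.1 hz
        by_cases hzw' : w = z
        · subst hzw'
          exact Finset.mem_biUnion.2 ⟨l, hl, Finset.mem_biUnion.2
            ⟨x l, Finset.mem_insert_self _ _, by simpa using (mem_leaves.1 hw).1⟩⟩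
        · have hz' := (Finset.mem_insert.1 hzw).resolve_left (Ne.symm hzw')
          obtain ⟨-, hz1, hz2⟩ := Finset.mem_filter.1 hz'
          have hl' : l ≤ m := by simpa [I, Nat.lt_succ_iff] using hl
          by_cases hx : ∀ i ≤ m, ¬ H.Adj (x i) z
          · obtain ⟨i, hi, u, hu, huz⟩ := hno z l hl' w hw hz1.symm hzw' hz2 hx
            exact Finset.mem_biUnion.2 ⟨i, by simpa [I, Nat.lt_succ_iff] using hi,
              Finset.mem_biUnion.2 ⟨u, Finset.mem_insert_of_mem hu, by simpa using huz.symm⟩⟩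
          · push Not at hx
            obtain ⟨i, hi, hiz⟩ := hx
            exact Finset.mem_biUnion.2 ⟨i, by simpa [I, Nat.lt_succ_iff] using hi,
              Finset.mem_biUnion.2 ⟨x i, Finset.mem_insert_self _ _, by simpa using hiz⟩⟩
    have h1 := Finset.card_le_card hsub
    rw [Finset.card_insert_of_notMem hvE, Finset.card_biUnion hdisj] at h1
    have h2 : (I.biUnion D).card ≤ ∑ l ∈ I, (D l).card := Finset.card_biUnion_le
    have h3 : ∑ l ∈ I, (D l).card ≤ ∑ l ∈ I, (E l).card :=
      Finset.sum_le_sum fun l hl ↦ (hD l).trans (hE l hl)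
    omega
  have hold : ∀ i ≤ m, Function.update x (m + 1) z i = x i := fun i hi ↦
    Function.update_of_ne (by omega) _ _
  have hnew : Function.update x (m + 1) z (m + 1) = z := Function.update_self _ _ _
  refine ⟨z, h.inj, by rw [hold 0 (Nat.zero_le _), h.root], h.root_color, ?_, ?_, ?_, ?_, ?_⟩
  · intro j hj i hi
    rw [hold i (by omega)]
    rcases Nat.lt_or_eq_of_le hj with hj | rfl
    · rw [hold j (by omega)]; exact h.center j (by omega) i hi
    · rw [hnew]; exact hzx i (by omega)
  · intro j hj i hi
    rw [hold i (by omega)]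
    rcases Nat.lt_or_eq_of_le hj with hj | rfl
    · rw [hold j (by omega)]; exact h.leaf j (by omega) i hi
    · rw [hnew]; exact hzl i (by omega)
  · intro j hj hj0
    rcases Nat.lt_or_eq_of_le hj with hj | rfl
    · rw [hold j (by omega)]
      obtain ⟨i, hi, hrest⟩ := h.parent j (by omega) hj0
      exact ⟨i, hi, by rw [hold i (by omega)]; exact hrest⟩
    · rw [hnew]
      refine ⟨l, by omega, ?_⟩
      rw [hold l hl]
      exact ⟨w, hw, hpz, hwz, hyz⟩
  · intro j hj
    rw [hold j (by omega)]
    exact hnon j (by omega)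
  · intro a b hab hc
    exact (hconf a b hab hc).imp_right .inl

theorem exists_coloring (h : StarSequence H p α v c m x) (hd2 : 2 ≤ d)
    (hdeg : ∀ u, H.degree u ≤ d)
    (hpart : ∀ w, 3 * d - 1 ≤ (Finset.univ.filter fun a ↦ p a = p w).card) :
    ∃ c' : V → κ, (∀ a b, p a = p b → c' a = c' b → a = b) ∧
      ∀ a b, H.Adj a b → c' a ≠ c' b := by
  induction hs : sizes H α c m x using WellFoundedLT.induction generalizing c m x with
  | ind s ih =>
  subst hs
  rcases (leaves H c α (x m)).eq_empty_or_nonempty with he | hne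
  · rcases Nat.eq_zero_or_pos m with rfl | hm
    · refine ⟨c, h.inj, fun a b hab hc ↦ ?_⟩
      rw [h.root] at he
      have hv : ∀ b, H.Adj v b → c v ≠ c b := by
        intro b hb hcb
        have : b ∈ leaves H c α v := mem_leaves.2 ⟨hb, by rw [← hcb, h.root_color]⟩
        simp [he] at this
      have := h.conflict a b hab hc
      rw [h.root] at this
      have : a = v ∨ b = v := by tauto
      rcases this with rfl | rfl
      · exact hv b hab hc
      · exact hv a hab.symm hc.symm
    · obtain ⟨c', l, hl, h', heq, hlt⟩ := h.shift hm he
      refine ih _ ?_ h' rfl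
      refine ⟨⟨l, hl.trans h.lt_card⟩, fun i hi ↦ ?_, ?_⟩
      · have hi' : (i : ℕ) < l := hi
        simp [sizes_apply, hi'.le, (hi'.trans hl).le, heq i hi']
      · simpa [sizes_apply, hl.le] using hlt
  · obtain ⟨z, h'⟩ := h.extend hne hd2 hdeg hpart
    refine ih _ ?_ h' rfl
    refine ⟨⟨m + 1, h'.lt_card⟩, fun i hi ↦ ?_, ?_⟩
    · have hi' : (i : ℕ) < m + 1 := hi
      have hne : (i : ℕ) ≠ m + 1 := by omega
      simp [sizes_apply, hi'.le, Nat.lt_succ_iff.1 hi', Function.update_of_ne hne]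
    · simpa [sizes_apply] using Nat.lt_succ_of_le (Finset.card_le_univ _)

end StarSequence

end Stars

section StrongColoring

variable {V ι κ : Type*} [Fintype V] [DecidableEq ι] {d : ℕ}

/-- A coloring that is injective on all parts, each of size at least `3 * d - 1`, can be replaced
by one that is also a proper coloring of a given graph of maximum degree at most `d`. -/
theorem exists_proper_coloring_injOn_parts [DecidableEq V] [DecidableEq κ] (H : SimpleGraph V)
    [DecidableRel H.Adj] (p : V → ι) (c₀ : V → κ) (hc₀ : ∀ a b, p a = p b → c₀ a = c₀ b → a = b)
    (hd2 : 2 ≤ d) (hdeg : ∀ u, H.degree u ≤ d)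
    (hpart : ∀ w, 3 * d - 1 ≤ (Finset.univ.filter fun a ↦ p a = p w).card) :
    ∃ c : V → κ, (∀ a b, p a = p b → c a = c b → a = b) ∧ ∀ a b, H.Adj a b → c a ≠ c b := by
  suffices ∀ B : Finset V, ∃ c : V → κ, (∀ a b, p a = p b → c a = c b → a = b) ∧
      ∀ a b, H.Adj a b → a ∈ B → b ∈ B → c a ≠ c b by
    obtain ⟨c, h1, h2⟩ := this Finset.univ
    exact ⟨c, h1, fun a b hab ↦ h2 a b hab (Finset.mem_univ _) (Finset.mem_univ _)⟩
  intro B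
  induction B using Finset.induction_on with
  | empty => exact ⟨c₀, hc₀, by simp⟩
  | insert v B _ ih =>
    obtain ⟨c, hinj, hc⟩ := ih
    let K : SimpleGraph V :=
      { Adj := fun a b ↦ H.Adj a b ∧ a ∈ insert v B ∧ b ∈ insert v B
        symm := ⟨fun a b h ↦ ⟨h.1.symm, h.2.2, h.2.1⟩⟩
        loopless := ⟨fun a h ↦ h.1.ne rfl⟩ }
    have : DecidableRel K.Adj := fun a b ↦
      inferInstanceAs (Decidable (H.Adj a b ∧ a ∈ insert v B ∧ b ∈ insert v B))
    have hK : StarSequence K p (c v) v c 0 fun _ ↦ v := by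
      refine ⟨hinj, rfl, rfl, by simp, by simp, by omega, by simp, ?_⟩
      rintro a b ⟨hab, ha, hb⟩ hcab
      by_contra! hne
      exact hc a b hab (Finset.mem_of_mem_insert_of_ne ha hne.1)
        (Finset.mem_of_mem_insert_of_ne hb hne.2.1) hcab
    have hKH : K ≤ H := fun a b h ↦ h.1
    obtain ⟨c', h1, h2⟩ := hK.exists_coloring hd2
      (fun u ↦ (SimpleGraph.degree_le_of_le hKH).trans (hdeg u)) hpart
    exact ⟨c', h1, fun a b hab ha hb ↦ h2 a b ⟨hab, ha, hb⟩⟩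

/-- **Haxell's theorem**: a graph of maximum degree at most `d` is strongly `r`-colorable for all
`r ≥ 3 * d - 1`. -/
theorem exists_strong_coloring [Fintype ι] (H : SimpleGraph V) [DecidableRel H.Adj] (p : V → ι)
    {r : ℕ} (hd2 : 2 ≤ d) (hr : 3 * d - 1 ≤ r) (hdeg : ∀ u, H.degree u ≤ d)
    (hpart : ∀ i, (Finset.univ.filter fun a ↦ p a = i).card ≤ r) :
    ∃ c : V → Fin r, (∀ a b, p a = p b → c a = c b → a = b) ∧ ∀ a b, H.Adj a b → c a ≠ c b := by
  classical
  have hemb : ∀ i, Nonempty ({a // p a = i} ↪ Fin r) := fun i ↦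
    Function.Embedding.nonempty_of_card_le (by simpa [Fintype.card_subtype] using hpart i)
  let f : ∀ i, {a // p a = i} ↪ Fin r := fun i ↦ (hemb i).some
  let e : V ↪ ι × Fin r :=
    ⟨fun a ↦ (p a, f (p a) ⟨a, rfl⟩), by
      intro a b hab
      obtain ⟨h1, h2⟩ := Prod.mk.inj hab
      have : ∀ i (hi : p b = i), f i ⟨b, hi⟩ = f (p b) ⟨b, rfl⟩ := by rintro _ rfl; rfl
      rw [← this _ h1.symm] at h2
      exact congrArg Subtype.val ((f (p a)).injective h2)⟩
  have hdeg' : ∀ u, (H.map e).degree u ≤ d := by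
    intro u
    by_cases hu : ∃ a, e a = u
    · obtain ⟨a, rfl⟩ := hu
      refine le_trans ?_ (hdeg a)
      rw [← card_neighborFinset_eq_degree, ← card_neighborFinset_eq_degree,
        ← Finset.card_map e]
      refine Finset.card_le_card fun z hz ↦ ?_
      rw [mem_neighborFinset, map_adj] at hz
      obtain ⟨a', b, hab, ha', rfl⟩ := hz
      obtain rfl := e.injective ha'
      simpa using hab
    · refine le_trans (le_of_eq ?_) (Nat.zero_le d)
      rw [← card_neighborFinset_eq_degree, Finset.card_eq_zero, Finset.eq_empty_iff_forall_notMem]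
      intro z hz
      rw [mem_neighborFinset, map_adj] at hz
      obtain ⟨a, b, -, ha, -⟩ := hz
      exact hu ⟨a, ha⟩
  obtain ⟨c, h1, h2⟩ := exists_proper_coloring_injOn_parts (H.map e) Prod.fst Prod.snd
    (fun a b h h' ↦ Prod.ext h h') hd2 hdeg' (fun w ↦ by
      have : (Finset.univ.filter fun a : ι × Fin r ↦ a.1 = w.1) =
          Finset.univ.map (Function.Embedding.sectR w.1 (Fin r)) := by
        ext ⟨a, b⟩
        simp [eq_comm]
      rw [this, Finset.card_map, Finset.card_univ, Fintype.card_fin]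
      exact hr)
  refine ⟨fun a ↦ c (e a), fun a b hp hc ↦ e.injective (h1 _ _ hp hc), fun a b hab ↦ ?_⟩
  exact h2 _ _ ((map_adj _ _ _ _).2 ⟨a, b, hab, rfl, rfl⟩)

end StrongColoring

section MaximumCliques

theorem SimpleGraph.IsNClique.map_iso {V W : Type*} {G : SimpleGraph V} {H : SimpleGraph W} {n : ℕ}
    {Q : Finset V} (hQ : G.IsNClique n Q) (e : G ≃g H) :
    H.IsNClique n (Q.map e.toEquiv.toEmbedding) := by
  refine ⟨?_, by rw [Finset.card_map, hQ.card_eq]⟩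
  intro a ha b hb hab
  obtain ⟨a', ha', rfl⟩ := Finset.mem_map.1 (Finset.mem_coe.1 ha)
  obtain ⟨b', hb', rfl⟩ := Finset.mem_map.1 (Finset.mem_coe.1 hb)
  exact e.map_adj_iff.2 (hQ.isClique ha' hb' fun h ↦ hab (h ▸ rfl))

variable {V : Type*} [Fintype V] {G : SimpleGraph V}

theorem VertexTransitive.exists_mem_maximum_clique (hvt : VertexTransitive G) (v : V) :
    ∃ Q, G.IsNClique G.cliqueNum Q ∧ v ∈ Q := by
  obtain ⟨Q, hQ⟩ := G.exists_isNClique_cliqueNum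
  have hpos : 0 < Q.card := by
    have h1 : G.IsClique ({v} : Finset V) := by simp
    have := h1.card_le_cliqueNum
    rw [hQ.card_eq]
    simpa [Nat.pos_iff_ne_zero, Nat.one_le_iff_ne_zero] using this
  obtain ⟨u, hu⟩ := Finset.card_pos.1 hpos
  obtain ⟨e, he⟩ := hvt u v
  exact ⟨Q.map e.toEquiv.toEmbedding, hQ.map_iso e, Finset.mem_map.2 ⟨u, hu, he⟩⟩

variable [DecidableEq V]

/-- Hajnal's inequality for a nonempty family of maximum cliques. -/
theorem two_mul_cliqueNum_le_card_inter_add_card_union {F : Finset (Finset V)}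
    (hF : F.Nonempty) (hclique : ∀ Q ∈ F, G.IsNClique G.cliqueNum Q) :
    2 * G.cliqueNum ≤ (Finset.univ.filter fun x ↦ ∀ Q ∈ F, x ∈ Q).card + (F.sup id).card := by
  induction hF using Finset.Nonempty.cons_induction with
  | singleton Q =>
    have := (hclique Q (by simp)).card_eq
    simp [this, two_mul]
  | cons Q F hQ hF ih =>
    have ih := ih fun R hR ↦ hclique R (by simp [hR])
    have hQc := hclique Q (by simp)
    set I := Finset.univ.filter fun x ↦ ∀ R ∈ F, x ∈ R with hI
    set U := F.sup id with hU
    have hIU : I ⊆ U := by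
      intro x hx
      obtain ⟨R, hR⟩ := hF
      exact Finset.mem_sup.2 ⟨R, hR, (Finset.mem_filter.1 hx).2 R hR⟩
    have hadj : ∀ x ∈ I, ∀ y ∈ U, x ≠ y → G.Adj x y := by
      intro x hx y hy hxy
      obtain ⟨R, hR, hyR⟩ := Finset.mem_sup.1 hy
      exact (hclique R (by simp [hR])).isClique ((Finset.mem_filter.1 hx).2 R hR) hyR hxy
    have hcl : G.IsClique (I ∪ Q ∩ U : Finset V) := by
      intro x hx y hy hxy
      simp only [Finset.coe_union, Finset.coe_inter, Set.mem_union, Set.mem_inter_iff,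
        Finset.mem_coe] at hx hy
      rcases hx with hx | hx
      · rcases hy with hy | hy
        · exact hadj x hx y (hIU hy) hxy
        · exact hadj x hx y hy.2 hxy
      · rcases hy with hy | hy
        · exact (hadj y hy x hx.2 hxy.symm).symm
        · exact hQc.isClique hx.1 hy.1 hxy
    have h1 := hcl.card_le_cliqueNum
    have h2 := Finset.card_union_add_card_inter I (Q ∩ U)
    have h3 : I ∩ (Q ∩ U) = I ∩ Q := by
      ext x
      simp only [Finset.mem_inter]
      exact ⟨fun h ↦ ⟨h.1, h.2.1⟩, fun h ↦ ⟨h.1, h.2, hIU h.1⟩⟩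
    have h4 := Finset.card_union_add_card_inter Q U
    have h5 : (Finset.univ.filter fun x ↦ ∀ R ∈ Finset.cons Q F hQ, x ∈ R) = I ∩ Q := by
      ext x
      simp [hI, and_comm]
    have h6 : (Finset.cons Q F hQ).sup id = Q ∪ U := by simp [hU]
    have h7 := hQc.card_eq
    rw [h5, h6]
    rw [h3] at h2
    omega

variable [DecidableRel G.Adj]

theorem VertexTransitive.card_maximum_cliques (hvt : VertexTransitive G) (u v : V) :
    (Finset.univ.filter fun Q ↦ G.IsNClique G.cliqueNum Q ∧ u ∈ Q).card ≤
      (Finset.univ.filter fun Q ↦ G.IsNClique G.cliqueNum Q ∧ v ∈ Q).card := by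
  obtain ⟨e, he⟩ := hvt u v
  refine Finset.card_le_card_of_injOn (fun Q ↦ Q.map e.toEquiv.toEmbedding) ?_
    (Finset.map_injective _).injOn
  intro Q hQ
  simp only [Finset.coe_filter, Finset.mem_univ, true_and, Set.mem_ofPred_eq] at hQ ⊢
  obtain ⟨hQ, hu⟩ := hQ
  exact ⟨hQ.map_iso e, Finset.mem_map.2 ⟨u, hu, he⟩⟩

/-- **Clique clustering**: in a vertex-transitive graph with `ω > (2/3)(Δ + 1)`, distinct maximum
cliques are disjoint. -/
theorem VertexTransitive.maximum_clique_unique (hvt : VertexTransitive G)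
    (hω : 2 * (G.maxDegree + 1) < 3 * G.cliqueNum) {Q R : Finset V}
    (hQ : G.IsNClique G.cliqueNum Q) (hR : G.IsNClique G.cliqueNum R) {x : V}
    (hxQ : x ∈ Q) (hxR : x ∈ R) : Q = R := by
  let 𝒬 : V → Finset (Finset V) := fun x ↦
    Finset.univ.filter fun Q ↦ G.IsNClique G.cliqueNum Q ∧ x ∈ Q
  let F : V → Finset V := fun x ↦ Finset.univ.filter fun y ↦ ∀ Q ∈ 𝒬 x, y ∈ Q
  have mem𝒬 : ∀ {x Q}, Q ∈ 𝒬 x ↔ G.IsNClique G.cliqueNum Q ∧ x ∈ Q := by simp [𝒬]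
  have hnb : ∀ {x Q}, Q ∈ 𝒬 x → Q ⊆ insert x (G.neighborFinset x) := by
    intro x Q hQ y hy
    rw [Finset.mem_insert, mem_neighborFinset]
    by_cases hxy : y = x
    · exact .inl hxy
    · exact .inr ((mem𝒬.1 hQ).1.isClique (mem𝒬.1 hQ).2 hy (Ne.symm hxy))
  have hN : ∀ x, (insert x (G.neighborFinset x)).card ≤ G.maxDegree + 1 := fun x ↦
    (Finset.card_insert_le _ _).trans (Nat.succ_le_succ (G.degree_le_maxDegree x))
  have hF : ∀ x, G.maxDegree + 1 < 3 * (F x).card := by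
    intro x
    obtain ⟨P, hP, hxP⟩ := hvt.exists_mem_maximum_clique x
    have h1 := two_mul_cliqueNum_le_card_inter_add_card_union (F := 𝒬 x)
      ⟨P, mem𝒬.2 ⟨hP, hxP⟩⟩ fun Q hQ ↦ (mem𝒬.1 hQ).1
    have h2 : ((𝒬 x).sup id).card ≤ G.maxDegree + 1 :=
      (Finset.card_le_card (Finset.sup_le fun Q hQ ↦ hnb hQ)).trans (hN x)
    change _ ≤ (F x).card + _ at h1
    omega
  have h𝒬 : ∀ {x y}, y ∈ F x → 𝒬 x = 𝒬 y := fun {x y} hy ↦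
    Finset.eq_of_subset_of_card_le
      (fun Q hQ ↦ mem𝒬.2 ⟨(mem𝒬.1 hQ).1, (Finset.mem_filter.1 hy).2 Q hQ⟩)
      (hvt.card_maximum_cliques y x)
  have hsub : ∀ {x Q}, Q ∈ 𝒬 x → F x ⊆ Q := fun hQ y hy ↦ (Finset.mem_filter.1 hy).2 _ hQ
  have hdisj : ∀ {a b S}, S ∈ 𝒬 a → S ∉ 𝒬 b → Disjoint (F a) (F b) := by
    intro a b S ha hb
    refine Finset.disjoint_left.2 fun z hza hzb ↦ hb ?_
    rwa [h𝒬 hzb, ← h𝒬 hza]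
  by_contra hne
  have hcard : Q.card = R.card := hQ.card_eq.trans hR.card_eq.symm
  obtain ⟨y, hyQ, hyR⟩ : ∃ y ∈ Q, y ∉ R := Finset.not_subset.1 fun h ↦
    hne (Finset.eq_of_subset_of_card_le h hcard.ge)
  obtain ⟨z, hzR, hzQ⟩ : ∃ z ∈ R, z ∉ Q := Finset.not_subset.1 fun h ↦
    hne (Finset.eq_of_subset_of_card_le h hcard.le).symm
  have hxy : Disjoint (F x) (F y) := hdisj (mem𝒬.2 ⟨hR, hxR⟩) fun h ↦ hyR (mem𝒬.1 h).2
  have hxz : Disjoint (F x) (F z) := hdisj (mem𝒬.2 ⟨hQ, hxQ⟩) fun h ↦ hzQ (mem𝒬.1 h).2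
  have hyz : Disjoint (F y) (F z) := hdisj (mem𝒬.2 ⟨hQ, hyQ⟩) fun h ↦ hzQ (mem𝒬.1 h).2
  have hle : ((F x ∪ F y) ∪ F z).card ≤ G.maxDegree + 1 := by
    refine (Finset.card_le_card ?_).trans (hN x)
    refine Finset.union_subset (Finset.union_subset ?_ ?_) ?_
    · exact (hsub (mem𝒬.2 ⟨hQ, hxQ⟩)).trans (hnb (mem𝒬.2 ⟨hQ, hxQ⟩))
    · exact (hsub (mem𝒬.2 ⟨hQ, hyQ⟩)).trans (hnb (mem𝒬.2 ⟨hQ, hxQ⟩))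
    · exact (hsub (mem𝒬.2 ⟨hR, hzR⟩)).trans (hnb (mem𝒬.2 ⟨hR, hxR⟩))
  rw [Finset.card_union_of_disjoint (Finset.disjoint_union_left.2 ⟨hxz, hyz⟩),
    Finset.card_union_of_disjoint hxy] at hle
  have := hF x
  have := hF y
  have := hF z
  omega

/-- A vertex-transitive graph with large maximum cliques is `r`-colorable if `r` is at least the
size of these cliques and large compared to the number of neighbors outside of them. -/
theorem VertexTransitive.colorable_of_cliqueNum (hvt : VertexTransitive G)
    (hω : 2 * (G.maxDegree + 1) < 3 * G.cliqueNum) {d r : ℕ} (hd2 : 2 ≤ d)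
    (hd : G.maxDegree + 1 ≤ G.cliqueNum + d) (hr : 3 * d - 1 ≤ r) (hωr : G.cliqueNum ≤ r) :
    G.Colorable r := by
  choose p hp hmem using hvt.exists_mem_maximum_clique
  have hpeq : ∀ {a b}, a ∈ p b → p a = p b := fun {a b} hab ↦
    hvt.maximum_clique_unique hω (hp a) (hp b) (hmem a) hab
  let H : SimpleGraph V :=
    { Adj := fun a b ↦ G.Adj a b ∧ p a ≠ p b
      symm := ⟨fun a b h ↦ ⟨h.1.symm, h.2.symm⟩⟩
      loopless := ⟨fun a h ↦ h.1.ne rfl⟩ }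
  have : DecidableRel H.Adj := fun a b ↦ inferInstanceAs (Decidable (G.Adj a b ∧ p a ≠ p b))
  have hdeg : ∀ u, H.degree u ≤ d := by
    intro u
    have hdisj : Disjoint (H.neighborFinset u) (p u) :=
      Finset.disjoint_left.2 fun z hz hzu ↦
        ((H.mem_neighborFinset u z).1 hz).2 (hpeq hzu).symm
    have hsub : H.neighborFinset u ∪ p u ⊆ insert u (G.neighborFinset u) := by
      intro z hz
      rw [Finset.mem_insert, mem_neighborFinset]
      rcases Finset.mem_union.1 hz with hz | hz
      · exact .inr ((H.mem_neighborFinset u z).1 hz).1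
      · by_cases hzu : z = u
        · exact .inl hzu
        · exact .inr ((hp u).isClique (hmem u) hz (Ne.symm hzu))
    have h1 := Finset.card_le_card hsub
    have h2 := Finset.card_insert_le u (G.neighborFinset u)
    have h3 := G.degree_le_maxDegree u
    rw [Finset.card_union_of_disjoint hdisj, (hp u).card_eq] at h1
    rw [card_neighborFinset_eq_degree] at h1 h2
    omega
  obtain ⟨c, h1, h2⟩ := exists_strong_coloring H p hd2 hr hdeg fun Q ↦ by
    refine le_trans ?_ hωr
    rcases (Finset.univ.filter fun a ↦ p a = Q).eq_empty_or_nonempty with he | ⟨a, ha⟩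
    · simp [he]
    · obtain rfl := (Finset.mem_filter.1 ha).2
      rw [← (hp a).card_eq]
      refine Finset.card_le_card fun b hb ↦ ?_
      rw [← (Finset.mem_filter.1 hb).2]
      exact hmem b
  refine ⟨Coloring.mk c fun {a b} hab ↦ ?_⟩
  by_cases hpab : p a = p b
  · exact fun hc ↦ hab.ne (h1 a b hpab hc)
  · exact h2 a b ⟨hab, hpab⟩

end MaximumCliques

/-- If every vertex-transitive graph `H` satisfies Reed's bound
`χ(H) ≤ ⌈(ω(H) + Δ(H) + 1)/2⌉`, then every vertex-transitive graph `G` with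
`Δ(G) ≥ 9` and no clique on `Δ(G)` vertices satisfies `χ(G) ≤ Δ(G) − 1`. -/
theorem borodin_kostochka_from_reed
    (reed : ∀ (W : Type) [Fintype W] [DecidableEq W] (H : SimpleGraph W)
      [DecidableRel H.Adj], VertexTransitive H →
        H.chromaticNumber ≤ ((H.cliqueNum + H.maxDegree + 2) / 2 : ℕ))
    {V : Type} [Fintype V] [DecidableEq V] (G : SimpleGraph V) [DecidableRel G.Adj]
    (hvt : VertexTransitive G) (hΔ : 9 ≤ G.maxDegree)
    (hK : ¬ ∃ s : Finset V, G.IsNClique G.maxDegree s) :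
    G.chromaticNumber ≤ (G.maxDegree - 1 : ℕ) := by
  have hω : G.cliqueNum < G.maxDegree := by
    by_contra! h
    obtain ⟨Q, hQ⟩ := G.exists_isNClique_cliqueNum
    obtain ⟨s, hs, hcard⟩ := Finset.exists_subset_card_eq (h.trans_eq hQ.card_eq.symm)
    exact hK ⟨s, hQ.isClique.subset (Finset.coe_subset.2 hs), hcard⟩
  by_cases h : G.cliqueNum + 3 ≤ G.maxDegree
  · exact (reed V G hvt).trans (Nat.cast_le.2 (by omega))
  · exact (hvt.colorable_of_cliqueNum (d := 3) (by omega) (by omega) (by omega) (by omega)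
      (by omega)).chromaticNumber_le
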